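/- arXiv:2401.13603 — 3 statements merged into one kernel-verified Lean document; each statement's English description precedes it below -/
import Mathlib

section
/- Let q be an indeterminate and, for t₂ ∈ ℂ, let M₂(t₂) be the 6×6 matrix over the polynomial ring ℂ[q] with rows (0, 0, 0, 3t₂q, 4q, 0), (4, 0, 0, t₂²q, 3t₂q, 4q), (−t₂, 4, 0, 0, 0, 0), (0, 4, 0, (1/6)t₂³q, t₂²q, 3t₂q), (0, −t₂, 4, 4, 0, 0), (0, 0, −t₂, 0, 4, 0). Let Δ(t₂) ∈ ℂ[q] be the resultant of the characteristic polynomial of M₂(t₂) with its derivative. Then for every t₂ ∈ ℂ, the coefficient of q^k in Δ(t₂) vanishes for all k ≤ 7, and the coefficient of q^8 equals −1208925819614629174706176·t₂². -/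
/-- The resultant of two polynomials `p` and `q`, computed as the determinant of
the Sylvester matrix built with respect to the degree bounds `m` for `p` and
`n` for `q`. -/
noncomputable def sylvesterRes {R : Type*} [CommRing R] (m n : ℕ)
    (p q : Polynomial R) : R :=
  (Matrix.of (fun i j : Fin (m + n) =>
    if (i : ℕ) < n then
      (if (j : ℕ) ≤ m + (i : ℕ) then p.coeff (m + (i : ℕ) - (j : ℕ)) else 0)
    else
      (if (j : ℕ) ≤ ((i : ℕ) - n) + n then
        q.coeff (((i : ℕ) - n) + n - (j : ℕ)) else 0))).det

open Polynomial in
/-- The energy-2 truncation of the Dubrovin operator of `Gr(2,4)` with bulk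
parameter supported on the Schubert class `σ₍₂₎`, as a matrix over `ℂ[q]`. -/
noncomputable def M2 (t : ℂ) : Matrix (Fin 6) (Fin 6) (Polynomial ℂ) :=
  !![0,          0,          0,          C (3 * t) * X,   4 * X,           0;
     4,          0,          0,          C (t ^ 2) * X,   C (3 * t) * X,   4 * X;
     C (-t),     4,          0,          0,               0,               0;
     0,          4,          0,          C (t ^ 3 / 6) * X, C (t ^ 2) * X, C (3 * t) * X;
     0,          C (-t),     4,          4,               0,               0;
     0,          0,          C (-t),     0,               4,               0]

set_option maxHeartbeats 4000000 in
open Polynomial in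
/-- The resultant of a monic sextic with its derivative is the determinant of multiplication by the
derivative modulo the sextic; `s₁, …, s₄` are the power sums of the roots. -/
theorem sylvesterRes_sextic_derivative {R : Type*} [CommRing R]
    (a0 a1 a2 a3 a4 a5 s1 s2 s3 s4 : R)
    (h1 : s1 = -a5) (h2 : s2 = -(s1 * a5) - 2 * a4)
    (h3 : s3 = -(s2 * a5) - s1 * a4 - 3 * a3)
    (h4 : s4 = -(s3 * a5) - s2 * a4 - s1 * a3 - 4 * a2) (p : R[X])
    (hp : p = X ^ 6 + C a5 * X ^ 5 + C a4 * X ^ 4 + C a3 * X ^ 3 + C a2 * X ^ 2 + C a1 * X +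
      C a0) :
    sylvesterRes 6 5 p (derivative p) =
      Matrix.det
      (!![-6, -s1, -s2, -s3, -s4;
        0, -6, -s1, -s2, -s3;
        0, 0, -6, -s1, -s2;
        0, 0, 0, -6, -s1;
        0, 0, 0, 0, -6;
        0, 0, 0, 0, 0] *
      !![a1, a0, 0, 0, 0, 0;
        a2, a1, a0, 0, 0, 0;
        a3, a2, a1, a0, 0, 0;
        a4, a3, a2, a1, a0, 0;
        a5, a4, a3, a2, a1, a0] +
      !![a1, 0, 0, 0, 0, 0;
        2 * a2, a1, 0, 0, 0, 0;
        3 * a3, 2 * a2, a1, 0, 0, 0;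
        4 * a4, 3 * a3, 2 * a2, a1, 0, 0;
        5 * a5, 4 * a4, 3 * a3, 2 * a2, a1, 0;
        6, 5 * a5, 4 * a4, 3 * a3, 2 * a2, a1]) := by
  have hc (k : ℕ) : p.coeff k = if k = 6 then 1 else if k = 5 then a5 else
      if k = 4 then a4 else if k = 3 then a3 else if k = 2 then a2 else if k = 1 then a1 else
      if k = 0 then a0 else 0 := by
    subst hp
    rcases k with _ | _ | _ | _ | _ | _ | _ | k <;>
      simp [coeff_X, coeff_C, coeff_X_pow]
  let T : Matrix (Fin 5) (Fin 5) R :=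
      !![1, a5, a4, a3, a2;
        0, 1, a5, a4, a3;
        0, 0, 1, a5, a4;
        0, 0, 0, 1, a5;
        0, 0, 0, 0, 1]
  let V : Matrix (Fin 6) (Fin 5) R :=
      !![6, 5 * a5, 4 * a4, 3 * a3, 2 * a2;
        0, 6, 5 * a5, 4 * a4, 3 * a3;
        0, 0, 6, 5 * a5, 4 * a4;
        0, 0, 0, 6, 5 * a5;
        0, 0, 0, 0, 6;
        0, 0, 0, 0, 0]
  set Q : Matrix (Fin 6) (Fin 5) R :=
      !![-6, -s1, -s2, -s3, -s4;
        0, -6, -s1, -s2, -s3;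
        0, 0, -6, -s1, -s2;
        0, 0, 0, -6, -s1;
        0, 0, 0, 0, -6;
        0, 0, 0, 0, 0]
  set U : Matrix (Fin 5) (Fin 6) R :=
      !![a1, a0, 0, 0, 0, 0;
        a2, a1, a0, 0, 0, 0;
        a3, a2, a1, a0, 0, 0;
        a4, a3, a2, a1, a0, 0;
        a5, a4, a3, a2, a1, a0]
  set W : Matrix (Fin 6) (Fin 6) R :=
      !![a1, 0, 0, 0, 0, 0;
        2 * a2, a1, 0, 0, 0, 0;
        3 * a3, 2 * a2, a1, 0, 0, 0;
        4 * a4, 3 * a3, 2 * a2, a1, 0, 0;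
        5 * a5, 4 * a4, 3 * a3, 2 * a2, a1, 0;
        6, 5 * a5, 4 * a4, 3 * a3, 2 * a2, a1]
  have hS : sylvesterRes 6 5 p (derivative p) = (Matrix.fromBlocks T U V W).det := by
    let e : Fin 5 ⊕ Fin 6 ≃ Fin (6 + 5) := finSumFinEquiv
    have hl (i : Fin 5) : (e (Sum.inl i) : ℕ) = i := rfl
    have hr (i : Fin 6) : (e (Sum.inr i) : ℕ) = 5 + i := rfl
    rw [sylvesterRes, ← Matrix.det_submatrix_equiv_self e]
    congr 1
    ext (i | i) (j | j) <;> simp only [Matrix.submatrix_apply, Matrix.of_apply, hl, hr] <;>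
      fin_cases i <;> fin_cases j <;> simp [T, U, V, W, coeff_derivative, hc] <;> norm_num <;> ring
  have hT : T.det = 1 := by
    rw [Matrix.det_of_isUpperTriangular]
    · simp [T, Fin.prod_univ_succ]
    · intro i j hij
      fin_cases i <;> fin_cases j <;> first | rfl | simp at hij
  have hV : Q * T + V = 0 := by
    ext i j
    fin_cases i <;> fin_cases j <;>
      simp [Q, T, V] <;> simp only [h4, h3, h2, h1] <;> ring
  have hmul : Matrix.fromBlocks 1 0 Q 1 * Matrix.fromBlocks T U V W =
      Matrix.fromBlocks T U 0 (Q * U + W) := by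
    simp [Matrix.fromBlocks_multiply, hV]
  have := congrArg Matrix.det hmul
  rw [Matrix.det_mul, Matrix.det_fromBlocks_zero₁₂, Matrix.det_fromBlocks_zero₂₁,
    hT] at this
  simpa [hS] using this

set_option maxHeartbeats 4000000 in
open Polynomial in
/-- The characteristic polynomial of `M2 t`, in terms of `u = t / 6`. -/
theorem charpoly_M2 (t : ℂ) (u q : ℂ[X]) (hu : u = C (t / 6)) (hq : q = X) :
    (M2 t).charpoly = X ^ 6 + C (-36 * q * u ^ 3) * X ^ 5 + C (-180 * q * u ^ 2) * X ^ 4 +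
      C (-768 * q * u + 3888 * q ^ 2 * u ^ 5) * X ^ 3 +
      C (-1024 * q + 26352 * q ^ 2 * u ^ 4) * X ^ 2 + C (46080 * q ^ 2 * u ^ 3) * X +
      C (-36864 * q ^ 2 * u ^ 2 - 264384 * q ^ 3 * u ^ 6) := by
  have hM : M2 t = !![0, 0, 0, 18 * u * q, 4 * q, 0;
      4, 0, 0, 36 * u ^ 2 * q, 18 * u * q, 4 * q;
      -6 * u, 4, 0, 0, 0, 0;
      0, 4, 0, 36 * u ^ 3 * q, 36 * u ^ 2 * q, 18 * u * q;
      0, -6 * u, 4, 4, 0, 0;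
      0, 0, -6 * u, 0, 4, 0] := by
    have e1 : C (3 * t) = 18 * u := by
      rw [hu, ← C_ofNat, ← C_mul]; congr 1; ring
    have e2 : C (t ^ 2) = 36 * u ^ 2 := by
      rw [hu, ← C_ofNat, ← C_pow, ← C_mul]; congr 1; ring
    have e3 : C (t ^ 3 / 6) = 36 * u ^ 3 := by
      rw [hu, ← C_ofNat, ← C_pow, ← C_mul]; congr 1; ring
    have e4 : C (-t) = -6 * u := by
      rw [hu, neg_mul, ← C_ofNat, ← C_mul, ← C_neg]; congr 1; ring
    rw [M2, e1, e2, e3, e4, hq]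
  rw [hM, Matrix.charpoly]
  clear hM hu hq
  simp [Matrix.charmatrix_apply, Matrix.det_succ_row_zero, Fin.sum_univ_succ, Fin.succAbove,
    Matrix.diagonal_apply, map_ofNat]
  ring

set_option maxHeartbeats 4000000 in
/-- The determinant of multiplication by the derivative of the characteristic polynomial modulo that
polynomial. -/
theorem det_derivative_mul {R : Type*} [CommRing R] (q u : R) :
    Matrix.det
      !![645120 * q ^ 2 * u ^ 3 + 2566080 * q ^ 3 * u ^ 7 + 16796160 * q ^ 4 * u ^ 11
          + 60466176 * q ^ 5 * u ^ 15,
        3096576 * q ^ 2 * u ^ 2 + 1378944 * q ^ 3 * u ^ 6 + 38631168 * q ^ 4 * u ^ 10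
          + 120932352 * q ^ 5 * u ^ 14,
        5505024 * q ^ 2 * u - 30191616 * q ^ 3 * u ^ 5 - 192782592 * q ^ 4 * u ^ 9
          - 1390722048 * q ^ 5 * u ^ 13 - 6530347008 * q ^ 6 * u ^ 17,
        4194304 * q ^ 2 - 129171456 * q ^ 3 * u ^ 4 - 1677376512 * q ^ 4 * u ^ 8
          - 9923171328 * q ^ 5 * u ^ 12 - 44261240832 * q ^ 6 * u ^ 16,
        -103809024 * q ^ 3 * u ^ 3 - 2329067520 * q ^ 4 * u ^ 7
          - 13423491072 * q ^ 5 * u ^ 11 - 65061605376 * q ^ 6 * u ^ 15,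
        150994944 * q ^ 3 * u ^ 2 + 3662807040 * q ^ 4 * u ^ 6 + 32262064128 * q ^ 5 * u ^ 10
          + 160598163456 * q ^ 6 * u ^ 14 + 444063596544 * q ^ 7 * u ^ 18;
      4096 * q + 69984 * q ^ 2 * u ^ 4 + 373248 * q ^ 3 * u ^ 8 + 1679616 * q ^ 4 * u ^ 12,
        497664 * q ^ 2 * u ^ 3 + 46656 * q ^ 3 * u ^ 7 + 3359232 * q ^ 4 * u ^ 11,
        2359296 * q ^ 2 * u ^ 2 - 11218176 * q ^ 3 * u ^ 6 - 28553472 * q ^ 4 * u ^ 10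
          - 181398528 * q ^ 5 * u ^ 14,
        2359296 * q ^ 2 * u - 68014080 * q ^ 3 * u ^ 5 - 207339264 * q ^ 4 * u ^ 9
          - 1229478912 * q ^ 5 * u ^ 13,
        -92897280 * q ^ 3 * u ^ 4 - 215364096 * q ^ 4 * u ^ 8 - 1807266816 * q ^ 5 * u ^ 12,
        84934656 * q ^ 3 * u ^ 3 + 895795200 * q ^ 4 * u ^ 7 + 3775776768 * q ^ 5 * u ^ 11
          + 12335099904 * q ^ 6 * u ^ 15;
      2304 * q * u + 7776 * q ^ 2 * u ^ 5 + 46656 * q ^ 3 * u ^ 9,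
        4096 * q - 12960 * q ^ 2 * u ^ 4 + 93312 * q ^ 3 * u ^ 8,
        82944 * q ^ 2 * u ^ 3 - 1353024 * q ^ 3 * u ^ 7 - 5038848 * q ^ 4 * u ^ 11,
        589824 * q ^ 2 * u ^ 2 - 8232192 * q ^ 3 * u ^ 6 - 34152192 * q ^ 4 * u ^ 10,
        -15261696 * q ^ 3 * u ^ 5 - 50201856 * q ^ 4 * u ^ 9,
        13271040 * q ^ 3 * u ^ 4 + 142953984 * q ^ 4 * u ^ 8 + 342641664 * q ^ 5 * u ^ 12;
      360 * q * u ^ 2 + 1296 * q ^ 2 * u ^ 6,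
        2304 * q * u - 5184 * q ^ 2 * u ^ 5,
        4096 * q - 77760 * q ^ 2 * u ^ 4 - 139968 * q ^ 3 * u ^ 8,
        -193536 * q ^ 2 * u ^ 3 - 948672 * q ^ 3 * u ^ 7,
        221184 * q ^ 2 * u ^ 2 - 72576 * q ^ 3 * u ^ 6,
        1327104 * q ^ 3 * u ^ 5 + 9517824 * q ^ 4 * u ^ 9;
      36 * q * u ^ 3,
        360 * q * u ^ 2,
        2304 * q * u - 11664 * q ^ 2 * u ^ 5,
        4096 * q - 105408 * q ^ 2 * u ^ 4,
        -230400 * q ^ 2 * u ^ 3,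
        221184 * q ^ 2 * u ^ 2 + 1586304 * q ^ 3 * u ^ 6;
      6,
        -180 * q * u ^ 3,
        -720 * q * u ^ 2,
        -2304 * q * u + 11664 * q ^ 2 * u ^ 5,
        -2048 * q + 52704 * q ^ 2 * u ^ 4,
        46080 * q ^ 2 * u ^ 3] =
      -43521329506126650289422336 * u ^ 2 * q ^ 8 + (-7686954824019619607369220096 * u ^ 6
          - 745337788862255847495262273536 * q * u ^ 10
          + 664031415865499486637306937344 * q ^ 2 * u ^ 14
          + 113930271711581064713411701506048 * q ^ 3 * u ^ 18
          + 684982139562529749319188737949696 * q ^ 4 * u ^ 22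
          + 2223817670488596819610191324512256 * q ^ 5 * u ^ 26
          + 19266817054494667406786808294408192 * q ^ 6 * u ^ 30
          + 91159484481289757753213516343410688 * q ^ 7 * u ^ 34
          + 77443470614401225330030541153501184 * q ^ 8 * u ^ 38
          - 121667174220322973455124833675247616 * q ^ 9 * u ^ 42
          + 312919679659792970794039545465667584 * q ^ 10 * u ^ 46) * q ^ 9 := by
  simp [Matrix.det_succ_row_zero, Fin.sum_univ_succ, Fin.succAbove]
  ring

set_option maxHeartbeats 4000000 in
open Polynomial in
/-- The discriminant of `M2 t` is its order-`8` term up to higher order in `q`. -/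
theorem exists_sylvesterRes_M2_eq (t : ℂ) :
    ∃ r : ℂ[X], sylvesterRes 6 5 (M2 t).charpoly (derivative (M2 t).charpoly) =
      C (-1208925819614629174706176 * t ^ 2) * X ^ 8 + r * X ^ 9 := by
  obtain ⟨u, hu⟩ : ∃ u : ℂ[X], u = C (t / 6) := ⟨_, rfl⟩
  obtain ⟨q, hq⟩ : ∃ q : ℂ[X], q = X := ⟨_, rfl⟩
  have hc : C (-1208925819614629174706176 * t ^ 2) =
      -43521329506126650289422336 * u ^ 2 := by
    rw [hu, neg_mul, neg_mul, ← C_ofNat, ← C_pow, ← C_mul, ← C_neg]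
    congr 1
    ring
  rw [hc, ← hq, charpoly_M2 t u q hu hq, sylvesterRes_sextic_derivative _ _ _ _ _ _
    (36 * q * u ^ 3) (360 * q * u ^ 2 + 1296 * q ^ 2 * u ^ 6)
    (2304 * q * u + 7776 * q ^ 2 * u ^ 5 + 46656 * q ^ 3 * u ^ 9)
    (4096 * q + 69984 * q ^ 2 * u ^ 4 + 373248 * q ^ 3 * u ^ 8 + 1679616 * q ^ 4 * u ^ 12)
    (by ring) (by ring) (by ring) (by ring) _ rfl]
  refine ⟨_, Eq.trans (congrArg Matrix.det ?_) (det_derivative_mul q u)⟩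
  clear hc hu hq
  refine Matrix.ext fun i j => ?_
  fin_cases i <;> fin_cases j <;> simp <;> ring

/-- The discriminant of `M2 t` vanishes to order `8` in `q`, with leading
coefficient `-1208925819614629174706176 · t₂²`. -/
theorem discrim_M2 (t : ℂ) :
    (∀ k : ℕ, k ≤ 7 →
      (sylvesterRes 6 5 (M2 t).charpoly (M2 t).charpoly.derivative).coeff k = 0) ∧
    (sylvesterRes 6 5 (M2 t).charpoly (M2 t).charpoly.derivative).coeff 8 =
      -1208925819614629174706176 * t ^ 2 := by
  obtain ⟨r, hr⟩ := exists_sylvesterRes_M2_eq t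
  rw [hr]
  refine ⟨fun k hk => ?_, ?_⟩
  · rw [Polynomial.coeff_add, Polynomial.coeff_C_mul_X_pow, Polynomial.coeff_mul_X_pow',
      if_neg (by lia), if_neg (by lia), add_zero]
  · rw [Polynomial.coeff_add, Polynomial.coeff_C_mul_X_pow, Polynomial.coeff_mul_X_pow',
      if_pos rfl, if_neg (by lia), add_zero]
end

section
/- For every nonzero t₂ ∈ ℂ, the 6×6 matrix M₂(t₂), viewed over the field of rational functions ℂ(q), with rows (0, 0, 0, 3t₂q, 4q, 0), (4, 0, 0, t₂²q, 3t₂q, 4q), (−t₂, 4, 0, 0, 0, 0), (0, 4, 0, (1/6)t₂³q, t₂²q, 3t₂q), (0, −t₂, 4, 4, 0, 0), (0, 0, −t₂, 0, 4, 0), has squarefree characteristic polynomial; equivalently, the resultant of its characteristic polynomial with its derivative is nonzero, i.e. M₂(t₂) has simple spectrum. -/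
open RatFunc in
/-- The energy-2 truncation of the Dubrovin operator of `Gr(2,4)` with bulk
parameter supported on the Schubert class `σ₍₂₎`, viewed over `ℂ(q)`. -/
noncomputable def M2R (t : ℂ) : Matrix (Fin 6) (Fin 6) (RatFunc ℂ) :=
  !![0,          0,          0,          C (3 * t) * X,   4 * X,           0;
     4,          0,          0,          C (t ^ 2) * X,   C (3 * t) * X,   4 * X;
     C (-t),     4,          0,          0,               0,               0;
     0,          4,          0,          C (t ^ 3 / 6) * X, C (t ^ 2) * X, C (3 * t) * X;
     0,          C (-t),     4,          4,               0,               0;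
     0,          0,          C (-t),     0,               4,               0]

open Polynomial in
/-- Reversing both indices of the Sylvester matrix and transposing identifies `sylvesterRes`
with Mathlib's resultant. -/
lemma sylvesterRes_eq_resultant {R : Type*} [CommRing R] {m n : ℕ} {p q : R[X]}
    (hp : p.natDegree ≤ m) (hq : q.natDegree ≤ n) :
    sylvesterRes m n p q = p.resultant q m n := by
  rw [sylvesterRes, Polynomial.resultant, ← Matrix.det_transpose (sylvester p q m n),
    ← Matrix.det_submatrix_equiv_self Fin.revPerm (sylvester p q m n).transpose]
  congr 1
  ext i j
  obtain ⟨i, rfl⟩ := Fin.revPerm.surjective i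
  simp only [Matrix.of_apply, Matrix.submatrix_apply, Matrix.transpose_apply, Fin.revPerm_apply,
    Fin.rev_rev, sylvester]
  induction i using Fin.addCases with
  | left k =>
    have hk := k.isLt
    have hj := j.isLt
    simp only [Fin.addCases_left, Fin.val_rev, Fin.val_castAdd, Set.mem_Icc]
    rw [if_neg (by omega)]
    split_ifs
    · congr 1; omega
    · exact coeff_eq_zero_of_natDegree_lt (by omega)
    · omega
    · rfl
  | right k =>
    have hk := k.isLt
    have hj := j.isLt
    simp only [Fin.addCases_right, Fin.val_rev, Fin.val_natAdd, Set.mem_Icc]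
    rw [if_pos (by omega)]
    split_ifs
    · congr 1; omega
    · exact coeff_eq_zero_of_natDegree_lt (by omega)
    · omega
    · rfl

open Polynomial in
/-- For a monic polynomial over a characteristic zero field, separability is detected by the
resultant with the derivative. -/
lemma Polynomial.Monic.resultant_derivative_ne_zero_iff {K : Type*} [Field K] [CharZero K]
    {p : K[X]} (hp : p.Monic) {n : ℕ} (hn : p.natDegree = n + 1) :
    p.resultant p.derivative (n + 1) n ≠ 0 ↔ p.Separable := by
  have h := Polynomial.resultant_eq_zero_iff (f := p) (g := p.derivative)
  rw [natDegree_derivative, hn, Nat.add_sub_cancel] at h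
  rw [Ne, h, Polynomial.Separable]
  simp [hp.ne_zero]

/-- The matrix of `M2R` over a commutative ring, with `d` in place of `a ^ 3 / 6`. -/
def energyTwoMatrix {R : Type*} [CommRing R] (a d q : R) : Matrix (Fin 6) (Fin 6) R :=
  !![0,  0,  0,  3 * a * q, 4 * q,     0;
     4,  0,  0,  a ^ 2 * q, 3 * a * q, 4 * q;
     -a, 4,  0,  0,         0,         0;
     0,  4,  0,  d * q,     a ^ 2 * q, 3 * a * q;
     0,  -a, 4,  4,         0,         0;
     0,  0,  -a, 0,         4,         0]

lemma energyTwoMatrix_map {R S : Type*} [CommRing R] [CommRing S] (φ : R →+* S) (a d q : R) :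
    (energyTwoMatrix a d q).map φ = energyTwoMatrix (φ a) (φ d) (φ q) := by
  ext i j
  fin_cases i <;> fin_cases j <;> simp [energyTwoMatrix, map_ofNat φ]

lemma M2R_eq_map (t : ℂ) :
    M2R t = (energyTwoMatrix (Polynomial.C t) (Polynomial.C (t ^ 3 / 6)) Polynomial.X).map
      (algebraMap (Polynomial ℂ) (RatFunc ℂ)) := by
  have h : RatFunc.C (3 : ℂ) = 3 := map_ofNat _ 3
  rw [energyTwoMatrix_map]
  ext i j
  fin_cases i <;> fin_cases j <;> simp [energyTwoMatrix, M2R, RatFunc.algebraMap_C, h]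

set_option maxHeartbeats 1000000 in
open Polynomial in
lemma energyTwoMatrix_charpoly (t q : ℂ) :
    (energyTwoMatrix t (t ^ 3 / 6) q).charpoly =
      X ^ 6 + C (-(t ^ 3 * q / 6)) * X ^ 5 + C (-(5 * t ^ 2 * q)) * X ^ 4
        + C (t ^ 5 * q ^ 2 / 2 - 128 * t * q) * X ^ 3
        + C (61 / 3 * t ^ 4 * q ^ 2 - 1024 * q) * X ^ 2 + C (640 / 3 * t ^ 3 * q ^ 2) * X
        + C (-(17 / 3 * t ^ 6 * q ^ 3) - 1024 * t ^ 2 * q ^ 2) := by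
  refine Polynomial.funext fun x => ?_
  rw [Matrix.eval_charpoly]
  simp [energyTwoMatrix, Matrix.det_succ_row_zero, Fin.sum_univ_succ, Fin.succAbove,
    Matrix.scalar_apply]
  ring

open Polynomial in
/-- At `q = -384 / t ^ 4` the substitution `x = 8 y / t` turns the characteristic polynomial
into a multiple of `y ^ 6 + 8 y ^ 5 + 30 y ^ 4 + 240 y ^ 3 + 828 y ^ 2 + 960 y + 648`. -/
lemma energyTwoMatrix_charpoly_separable {t : ℂ} (ht : t ≠ 0) :
    (energyTwoMatrix t (t ^ 3 / 6) (-384 / t ^ 4)).charpoly.Separable := by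
  rw [Polynomial.Separable, Polynomial.isCoprime_iff_aeval_ne_zero_of_isAlgClosed ℂ ℂ,
    energyTwoMatrix_charpoly]
  intro x
  obtain ⟨y, rfl⟩ : ∃ y, x = 8 * y / t := ⟨x * t / 8, by field_simp⟩
  by_contra! h
  obtain ⟨h0, h1⟩ := h
  simp only [derivative_add, derivative_mul, derivative_C, derivative_X_pow, derivative_X]
    at h1
  simp at h0 h1
  have e0 : y ^ 6 + 8 * y ^ 5 + 30 * y ^ 4 + 240 * y ^ 3 + 828 * y ^ 2 + 960 * y + 648 = 0 := by
    field_simp at h0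
    linear_combination h0 / (36 * 8 ^ 6)
  have e1 : 6 * y ^ 5 + 40 * y ^ 4 + 120 * y ^ 3 + 720 * y ^ 2 + 1656 * y + 960 = 0 := by
    field_simp at h1
    linear_combination h1 / (36 * 8 ^ 5)
  have : (1115819997696 : ℂ) = 0 := by
    linear_combination
      (4758677952 + 1288703760 * y + 272668344 * y ^ 2 + 89976394 * y ^ 3 + 9628998 * y ^ 4) * e0
      + (-2049795120 - 2092656408 * y - 429935982 * y ^ 2 - 67222626 * y ^ 3
        - 17135843 * y ^ 4 - 1604833 * y ^ 5) * e1
  norm_num at this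

/-- For every `t ≠ 0`, the matrix `M2R t` has squarefree characteristic polynomial;
equivalently the resultant of its characteristic polynomial with its derivative is
nonzero, i.e. it has simple spectrum. -/
theorem simple_spectrum_M2R (t : ℂ) (ht : t ≠ 0) :
    Squarefree (M2R t).charpoly ∧
      sylvesterRes 6 5 (M2R t).charpoly (M2R t).charpoly.derivative ≠ 0 := by
  set F := (energyTwoMatrix (Polynomial.C t) (Polynomial.C (t ^ 3 / 6)) Polynomial.X).charpoly
    with hF
  have hchar : (M2R t).charpoly = F.map (algebraMap (Polynomial ℂ) (RatFunc ℂ)) := by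
    rw [M2R_eq_map, Matrix.charpoly_map]
  have hspec : F.map (Polynomial.evalRingHom (-384 / t ^ 4)) =
      (energyTwoMatrix t (t ^ 3 / 6) (-384 / t ^ 4)).charpoly := by
    rw [hF, ← Matrix.charpoly_map, energyTwoMatrix_map]
    simp
  have hmonic : (M2R t).charpoly.Monic := Matrix.charpoly_monic _
  have hdeg : (M2R t).charpoly.natDegree = 5 + 1 := by simp [Matrix.charpoly_natDegree_eq_dim]
  have hres : F.resultant F.derivative (5 + 1) 5 ≠ 0 := by
    intro h
    refine ((Matrix.charpoly_monic _).resultant_derivative_ne_zero_iff (n := 5)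
      (by simp [Matrix.charpoly_natDegree_eq_dim])).2 (energyTwoMatrix_charpoly_separable ht) ?_
    rw [← hspec, Polynomial.derivative_map, Polynomial.resultant_map_map, h, map_zero]
  have hres' : (M2R t).charpoly.resultant (M2R t).charpoly.derivative (5 + 1) 5 ≠ 0 := by
    rw [hchar, Polynomial.derivative_map, Polynomial.resultant_map_map]
    exact (map_ne_zero_iff _ (RatFunc.algebraMap_injective ℂ)).2 hres
  refine ⟨((hmonic.resultant_derivative_ne_zero_iff hdeg).1 hres').squarefree, ?_⟩
  rw [sylvesterRes_eq_resultant hdeg.le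
    ((Polynomial.natDegree_derivative_le _).trans (by omega))]
  exact hres'
end

section
/- Let q be an indeterminate and, for t₃ ∈ ℂ, let M₃(t₃) be the 6×6 matrix over the polynomial ring ℂ[q] with rows (0, 0, 3t₃q, 0, 4q, 0), (4, 0, 0, 0, 0, 4q), (0, 4, 0, 0, 0, 3t₃q), (−t₃, 4, 0, 0, 0, 0), (0, −t₃, 4, 4, 0, 0), (0, 0, 0, −t₃, 4, 0). Let Δ(t₃) ∈ ℂ[q] be the resultant of the characteristic polynomial of M₃(t₃) with its derivative. Then for every t₃ ∈ ℂ, the coefficient of q^k in Δ(t₃) vanishes for all k ≤ 7, and the coefficient of q^8 equals −1208925819614629174706176·t₃². -/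
open Polynomial in
/-- The energy-2 truncation of the Dubrovin operator of `Gr(2,4)` with bulk
parameter supported on the Schubert class `σ₍₁,₁₎`, as a matrix over `ℂ[q]`. -/
noncomputable def M3 (t : ℂ) : Matrix (Fin 6) (Fin 6) (Polynomial ℂ) :=
  !![0,       0,       C (3 * t) * X, 0,       4 * X, 0;
     4,       0,       0,             0,       0,     4 * X;
     0,       4,       0,             0,       0,     C (3 * t) * X;
     C (-t),  4,       0,             0,       0,     0;
     0,       C (-t),  4,             4,       0,     0;
     0,       0,       0,             C (-t),  4,     0]

theorem det_sub_M3_entries {R : Type*} [CommRing R] (x q t : R) :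
    (!![x, 0, -(3 * t * q), 0, -(4 * q), 0;
        -4, x, 0, 0, 0, -(4 * q);
        0, -4, x, 0, 0, -(3 * t * q);
        t, -4, 0, x, 0, 0;
        0, t, -4, -4, x, 0;
        0, 0, 0, t, -4, x] : Matrix (Fin 6) (Fin 6) R).det =
      x ^ 6 + (-(32 * t * q)) * x ^ 3 + (-(9 * t ^ 4 * q ^ 2 + 1024 * q)) * x ^ 2
        + (352 * t ^ 3 * q ^ 2) * x + (-(1024 * t ^ 2 * q ^ 2)) := by
  simp [Matrix.det_succ_row_zero, Fin.sum_univ_succ, Fin.succAbove]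
  ring

set_option maxHeartbeats 2000000 in
open Polynomial Matrix in
theorem M3_charpoly (t : ℂ) :
    (M3 t).charpoly = X ^ 6 + C (-(32 * C t * X)) * X ^ 3
      + C (-(9 * C t ^ 4 * X ^ 2 + 1024 * X)) * X ^ 2
      + C (352 * C t ^ 3 * X ^ 2) * X + C (-(1024 * C t ^ 2 * X ^ 2)) := by
  have hC (n : ℕ) [n.AtLeastTwo] {S : Type} [CommRing S] :
      (C (OfNat.ofNat n : S) : S[X]) = OfNat.ofNat n := map_ofNat C n
  have h : (M3 t).charmatrix = !![X, 0, -(3 * C (C t) * C X), 0, -(4 * C X), 0;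
        -4, X, 0, 0, 0, -(4 * C X);
        0, -4, X, 0, 0, -(3 * C (C t) * C X);
        C (C t), -4, 0, X, 0, 0;
        0, C (C t), -4, -4, X, 0;
        0, 0, 0, C (C t), -4, X] := by
    ext1 i j
    fin_cases i <;> fin_cases j <;> simp [M3, hC]
  rw [Matrix.charpoly, h, det_sub_M3_entries]
  simp [hC]
  ring

/-- The Sylvester matrix of `X ^ 6 + b X ^ 3 + c X ^ 2 + d X + e` and its derivative. -/
def sylvesterDerivMatrix {R : Type*} [CommRing R] (b c d e : R) : Matrix (Fin 11) (Fin 11) R :=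
  !![1, 0, 0, b, c, d, e, 0, 0, 0, 0;
     0, 1, 0, 0, b, c, d, e, 0, 0, 0;
     0, 0, 1, 0, 0, b, c, d, e, 0, 0;
     0, 0, 0, 1, 0, 0, b, c, d, e, 0;
     0, 0, 0, 0, 1, 0, 0, b, c, d, e;
     6, 0, 0, 3 * b, 2 * c, d, 0, 0, 0, 0, 0;
     0, 6, 0, 0, 3 * b, 2 * c, d, 0, 0, 0, 0;
     0, 0, 6, 0, 0, 3 * b, 2 * c, d, 0, 0, 0;
     0, 0, 0, 6, 0, 0, 3 * b, 2 * c, d, 0, 0;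
     0, 0, 0, 0, 6, 0, 0, 3 * b, 2 * c, d, 0;
     0, 0, 0, 0, 0, 6, 0, 0, 3 * b, 2 * c, d]

/-- The row operations clearing the first five columns of `sylvesterDerivMatrix` below the
diagonal. -/
def rowOperations {R : Type*} [CommRing R] (b c : R) : Matrix (Fin 11) (Fin 11) R :=
  !![1, 0, 0, 0, 0, 0, 0, 0, 0, 0, 0;
     0, 1, 0, 0, 0, 0, 0, 0, 0, 0, 0;
     0, 0, 1, 0, 0, 0, 0, 0, 0, 0, 0;
     0, 0, 0, 1, 0, 0, 0, 0, 0, 0, 0;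
     0, 0, 0, 0, 1, 0, 0, 0, 0, 0, 0;
     -6, 0, 0, 3 * b, 4 * c, 1, 0, 0, 0, 0, 0;
     0, -6, 0, 0, 3 * b, 0, 1, 0, 0, 0, 0;
     0, 0, -6, 0, 0, 0, 0, 1, 0, 0, 0;
     0, 0, 0, -6, 0, 0, 0, 0, 1, 0, 0;
     0, 0, 0, 0, -6, 0, 0, 0, 0, 1, 0;
     0, 0, 0, 0, 0, 0, 0, 0, 0, 0, 1]

/-- The row-reduced form of `sylvesterDerivMatrix`. -/
def rowReduced {R : Type*} [CommRing R] (b c d e : R) : Matrix (Fin 11) (Fin 11) R :=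
  !![1, 0, 0, b, c, d, e, 0, 0, 0, 0;
     0, 1, 0, 0, b, c, d, e, 0, 0, 0;
     0, 0, 1, 0, 0, b, c, d, e, 0, 0;
     0, 0, 0, 1, 0, 0, b, c, d, e, 0;
     0, 0, 0, 0, 1, 0, 0, b, c, d, e;
     0, 0, 0, 0, 0, -(5 * d), 3 * b ^ 2 - 6 * e, 7 * b * c, 3 * b * d + 4 * c ^ 2,
       3 * b * e + 4 * c * d, 4 * c * e;
     0, 0, 0, 0, 0, -(4 * c), -(5 * d), 3 * b ^ 2 - 6 * e, 3 * b * c, 3 * b * d, 3 * b * e;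
     0, 0, 0, 0, 0, -(3 * b), -(4 * c), -(5 * d), -(6 * e), 0, 0;
     0, 0, 0, 0, 0, 0, -(3 * b), -(4 * c), -(5 * d), -(6 * e), 0;
     0, 0, 0, 0, 0, 0, 0, -(3 * b), -(4 * c), -(5 * d), -(6 * e);
     0, 0, 0, 0, 0, 6, 0, 0, 3 * b, 2 * c, d]

/-- The lower right block of `rowReduced`. -/
def reducedBlock {R : Type*} [CommRing R] (b c d e : R) : Matrix (Fin 6) (Fin 6) R :=
  !![-(5 * d), 3 * b ^ 2 - 6 * e, 7 * b * c, 3 * b * d + 4 * c ^ 2,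
       3 * b * e + 4 * c * d, 4 * c * e;
     -(4 * c), -(5 * d), 3 * b ^ 2 - 6 * e, 3 * b * c, 3 * b * d, 3 * b * e;
     -(3 * b), -(4 * c), -(5 * d), -(6 * e), 0, 0;
     0, -(3 * b), -(4 * c), -(5 * d), -(6 * e), 0;
     0, 0, -(3 * b), -(4 * c), -(5 * d), -(6 * e);
     6, 0, 0, 3 * b, 2 * c, d]

set_option maxHeartbeats 2000000 in
open Polynomial in
theorem sylvesterRes_derivative_eq_det {R : Type*} [CommRing R] (b c d e : R) :
    sylvesterRes 6 5 (X ^ 6 + C b * X ^ 3 + C c * X ^ 2 + C d * X + C e)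
      (derivative (X ^ 6 + C b * X ^ 3 + C c * X ^ 2 + C d * X + C e)) =
    (sylvesterDerivMatrix b c d e).det := by
  unfold sylvesterRes sylvesterDerivMatrix
  simp only [coeff_derivative]
  refine congrArg Matrix.det (Matrix.ext fun i j => ?_)
  fin_cases i <;> fin_cases j <;>
    simp [coeff_X, coeff_C, coeff_X_pow] <;> norm_num <;> ring

set_option maxHeartbeats 2000000 in
theorem sylvester_row_reduction {R : Type*} [CommRing R] (b c d e : R) :
    rowOperations b c * sylvesterDerivMatrix b c d e = rowReduced b c d e := by
  unfold rowOperations sylvesterDerivMatrix rowReduced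
  ext i j
  fin_cases i <;> fin_cases j <;>
    simp [Matrix.mul_apply, Fin.sum_univ_succ] <;> ring

theorem det_row_operations {R : Type*} [CommRing R] (b c : R) :
    (rowOperations b c).det = 1 := by
  rw [Matrix.det_of_isLowerTriangular]
  · simp [rowOperations, Fin.prod_univ_succ]
  · intro i j h
    fin_cases i <;> fin_cases j <;> first | rfl | (exact absurd h (by decide))

theorem det_eq_det_submatrix_succ {R : Type*} [CommRing R] {n : ℕ}
    (A : Matrix (Fin (n + 1)) (Fin (n + 1)) R) (h₀ : A 0 0 = 1) (h : ∀ i : Fin n, A i.succ 0 = 0) :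
    A.det = (A.submatrix Fin.succ Fin.succ).det := by
  rw [Matrix.det_succ_column_zero, Fin.sum_univ_succ, Finset.sum_eq_zero fun i _ => by simp [h]]
  simp [h₀]

theorem det_row_reduced {R : Type*} [CommRing R] (b c d e : R) :
    (rowReduced b c d e).det = (reducedBlock b c d e).det := by
  iterate 5
    rw [det_eq_det_submatrix_succ _ rfl (by intro i; fin_cases i <;> rfl)]
  refine congrArg Matrix.det (Matrix.ext fun i j => ?_)
  fin_cases i <;> fin_cases j <;> rfl

theorem det_reduced_block {R : Type*} [CommRing R] (b c d e : R) :
    (reducedBlock b c d e).det =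
      486 * b ^ 5 * c * d * e - 6912 * b * c ^ 4 * d * e - 21384 * b ^ 3 * c * d * e ^ 2
      + 77760 * b * c * d * e ^ 3 + 9720 * b ^ 2 * c ^ 2 * d ^ 2 * e - 43200 * c ^ 2 * d ^ 2 * e ^ 2
      + 27 * b ^ 4 * c ^ 2 * d ^ 2 - 256 * c ^ 5 * d ^ 2 + 1350 * b ^ 3 * d ^ 3 * e
      - 27000 * b * d ^ 3 * e ^ 2 + 1600 * b * c ^ 3 * d ^ 3 - 108 * b ^ 5 * d ^ 3
      + 22500 * c * d ^ 4 * e - 2250 * b ^ 2 * c * d ^ 4 - 3125 * d ^ 6 - 108 * b ^ 4 * c ^ 3 * e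
      + 1024 * c ^ 6 * e + 8640 * b ^ 2 * c ^ 3 * e ^ 2 - 729 * b ^ 6 * e ^ 2
      + 13824 * c ^ 3 * e ^ 3 + 8748 * b ^ 4 * e ^ 3 - 34992 * b ^ 2 * e ^ 4 + 46656 * e ^ 5 := by
  simp [reducedBlock, Matrix.det_succ_row_zero, Fin.sum_univ_succ, Fin.succAbove]
  ring

open Polynomial in
theorem sylvesterRes_derivative {R : Type*} [CommRing R] (b c d e : R) :
    sylvesterRes 6 5 (X ^ 6 + C b * X ^ 3 + C c * X ^ 2 + C d * X + C e)
      (derivative (X ^ 6 + C b * X ^ 3 + C c * X ^ 2 + C d * X + C e)) =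
      486 * b ^ 5 * c * d * e - 6912 * b * c ^ 4 * d * e - 21384 * b ^ 3 * c * d * e ^ 2
      + 77760 * b * c * d * e ^ 3 + 9720 * b ^ 2 * c ^ 2 * d ^ 2 * e - 43200 * c ^ 2 * d ^ 2 * e ^ 2
      + 27 * b ^ 4 * c ^ 2 * d ^ 2 - 256 * c ^ 5 * d ^ 2 + 1350 * b ^ 3 * d ^ 3 * e
      - 27000 * b * d ^ 3 * e ^ 2 + 1600 * b * c ^ 3 * d ^ 3 - 108 * b ^ 5 * d ^ 3
      + 22500 * c * d ^ 4 * e - 2250 * b ^ 2 * c * d ^ 4 - 3125 * d ^ 6 - 108 * b ^ 4 * c ^ 3 * e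
      + 1024 * c ^ 6 * e + 8640 * b ^ 2 * c ^ 3 * e ^ 2 - 729 * b ^ 6 * e ^ 2
      + 13824 * c ^ 3 * e ^ 3 + 8748 * b ^ 4 * e ^ 3 - 34992 * b ^ 2 * e ^ 4 + 46656 * e ^ 5 := by
  rw [sylvesterRes_derivative_eq_det, ← det_reduced_block, ← det_row_reduced,
    ← sylvester_row_reduction, Matrix.det_mul, det_row_operations, one_mul]

open Polynomial in
theorem sylvesterRes_M3_charpoly (t : ℂ) :
    sylvesterRes 6 5 (M3 t).charpoly (M3 t).charpoly.derivative =
      X ^ 8 * (C (-1208925819614629174706176 * t ^ 2) + X *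
        (-109845749272921952485376 * C t ^ 6
          - 8903445326525630513152 * C t ^ 10 * X
          + 337681769230007009280 * C t ^ 14 * X ^ 2
          - 2543401996862357504 * C t ^ 18 * X ^ 3
          + 1789922453225472 * C t ^ 22 * X ^ 4
          + 1315743989760 * C t ^ 26 * X ^ 5)) := by
  have hC : (C (-1208925819614629174706176 * t ^ 2) : ℂ[X]) =
      -1208925819614629174706176 * C t ^ 2 := by
    rw [C_mul, C_pow, C_neg]
    exact congrArg (fun y => -y * C t ^ 2) (map_ofNat C 1208925819614629174706176)
  rw [M3_charpoly, sylvesterRes_derivative, hC]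
  ring

/-- The discriminant of `M3 t` vanishes to order `8` in `q`, with leading
coefficient `-1208925819614629174706176 · t₃²`. -/
theorem discrim_M3 (t : ℂ) :
    (∀ k : ℕ, k ≤ 7 →
      (sylvesterRes 6 5 (M3 t).charpoly (M3 t).charpoly.derivative).coeff k = 0) ∧
    (sylvesterRes 6 5 (M3 t).charpoly (M3 t).charpoly.derivative).coeff 8 =
      -1208925819614629174706176 * t ^ 2 := by
  rw [sylvesterRes_M3_charpoly]
  refine ⟨fun k hk => ?_, ?_⟩
  · rw [Polynomial.coeff_X_pow_mul', if_neg (by omega)]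
  · simp [Polynomial.coeff_X_pow_mul']
    rw [← Polynomial.C_pow, Polynomial.coeff_C_zero]
end
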